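/- Let n, m ∈ ℕ, let R be the subring of the ring of germs at 0 of ℂ-valued functions on ℂⁿ consisting of germs of functions analytic at 0, with I₀ ⊆ R the ideal of analytic germs vanishing at 0, let A := R ⊗_ℂ Λ with Λ the exterior algebra of ℂ^m over ℂ, and let J₀ be the two-sided ideal of A generated by the elements r ⊗ 1 with r ∈ I₀ and the elements 1 ⊗ ι(v) for v ∈ ℂ^m. Then for a ℂ-linear functional φ : A → ℂ the following are equivalent: (i) there exists n ≥ 0 with φ vanishing on J₀^{n+1}; (ii) the kernel of φ contains a two-sided ideal of A of finite codimension over ℂ. -/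

import Mathlib

open Filter Topology
open scoped TensorProduct

/-- The subring of the ring of germs at `0` of `ℂ`-valued functions on `ℂⁿ` consisting of
germs of functions analytic at `0`. -/
noncomputable def analyticGerms (n : ℕ) :
    Subring (Filter.Germ (𝓝 (0 : Fin n → ℂ)) ℂ) where
  carrier := {φ | ∃ f : (Fin n → ℂ) → ℂ, AnalyticAt ℂ f 0 ∧ φ = ↑f}
  zero_mem' := ⟨fun _ => 0, analyticAt_const, rfl⟩
  one_mem' := ⟨fun _ => 1, analyticAt_const, rfl⟩
  add_mem' := by
    rintro a b ⟨f, hf, rfl⟩ ⟨g, hg, rfl⟩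
    exact ⟨fun x => f x + g x, hf.add hg, rfl⟩
  neg_mem' := by
    rintro a ⟨f, hf, rfl⟩
    exact ⟨fun x => -f x, hf.neg, rfl⟩
  mul_mem' := by
    rintro a b ⟨f, hf, rfl⟩ ⟨g, hg, rfl⟩
    exact ⟨fun x => f x * g x, hf.mul hg, rfl⟩

/-- Evaluation at `0` of an analytic germ at `0`, as a ring homomorphism. -/
noncomputable def evalAtZero (n : ℕ) : analyticGerms n →+* ℂ where
  toFun φ := Filter.Germ.liftOn φ.1 (fun f => f 0) fun _ _ H => H.eq_of_nhds
  map_one' := rfl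
  map_zero' := rfl
  map_mul' φ ψ := by
    obtain ⟨f, hf, hφ⟩ := φ.2
    obtain ⟨g, hg, hψ⟩ := ψ.2
    have h1 : (φ * ψ : analyticGerms n).1 = ((fun x => f x * g x : (Fin n → ℂ) → ℂ) :
        Filter.Germ (𝓝 (0 : Fin n → ℂ)) ℂ) := by
      show (φ.1 * ψ.1) = _
      rw [hφ, hψ]; rfl
    show Filter.Germ.liftOn (φ * ψ : analyticGerms n).1 _ _ =
      Filter.Germ.liftOn φ.1 (fun f => f 0) (fun _ _ H => H.eq_of_nhds) *
        Filter.Germ.liftOn ψ.1 (fun f => f 0) (fun _ _ H => H.eq_of_nhds)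
    rw [h1, hφ, hψ]
    rfl
  map_add' φ ψ := by
    obtain ⟨f, hf, hφ⟩ := φ.2
    obtain ⟨g, hg, hψ⟩ := ψ.2
    have h1 : (φ + ψ : analyticGerms n).1 = ((fun x => f x + g x : (Fin n → ℂ) → ℂ) :
        Filter.Germ (𝓝 (0 : Fin n → ℂ)) ℂ) := by
      show (φ.1 + ψ.1) = _
      rw [hφ, hψ]; rfl
    show Filter.Germ.liftOn (φ + ψ : analyticGerms n).1 _ _ =
      Filter.Germ.liftOn φ.1 (fun f => f 0) (fun _ _ H => H.eq_of_nhds) +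
        Filter.Germ.liftOn ψ.1 (fun f => f 0) (fun _ _ H => H.eq_of_nhds)
    rw [h1, hφ, hψ]
    rfl

/-- The constant germs, as a ring homomorphism `ℂ →+* analyticGerms n`. -/
noncomputable def constGerm (n : ℕ) : ℂ →+* analyticGerms n where
  toFun c := ⟨((fun _ => c : (Fin n → ℂ) → ℂ) : Filter.Germ (𝓝 (0 : Fin n → ℂ)) ℂ),
    ⟨fun _ => c, analyticAt_const, rfl⟩⟩
  map_one' := rfl
  map_zero' := rfl
  map_mul' _ _ := rfl
  map_add' _ _ := rfl

noncomputable instance (n : ℕ) : Algebra ℂ (analyticGerms n) := (constGerm n).toAlgebra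

/-- The ideal of analytic germs at `0` vanishing at `0`. -/
noncomputable def vanishingIdeal (n : ℕ) : Ideal (analyticGerms n) :=
  RingHom.ker (evalAtZero n)

/-- The stalk at the origin of the structure sheaf of the analytic supermanifold
`ℂ^{n|m}`: analytic germs at `0 ∈ ℂⁿ` tensored with the exterior algebra of `ℂᵐ`. -/
noncomputable abbrev SuperStalk (n m : ℕ) : Type :=
  analyticGerms n ⊗[ℂ] ExteriorAlgebra ℂ (Fin m → ℂ)

/-- The product of two two-sided ideals: the two-sided ideal generated by products. -/
noncomputable def tsiMul {A : Type*} [Ring A] (I J : TwoSidedIdeal A) : TwoSidedIdeal A :=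
  TwoSidedIdeal.span {x | ∃ a ∈ I, ∃ b ∈ J, x = a * b}

/-- Powers of a two-sided ideal. -/
noncomputable def tsiPow {A : Type*} [Ring A] (I : TwoSidedIdeal A) : ℕ → TwoSidedIdeal A
  | 0 => ⊤
  | 1 => I
  | (p + 2) => tsiMul (tsiPow I (p + 1)) I

/-- The underlying `ℂ`-submodule of a two-sided ideal in a `ℂ`-algebra. -/
noncomputable def tsiToSubmodule {A : Type*} [Ring A] [Algebra ℂ A]
    (J : TwoSidedIdeal A) : Submodule ℂ A where
  carrier := J
  zero_mem' := J.zero_mem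
  add_mem' := fun ha hb => J.add_mem ha hb
  smul_mem' := fun c x hx => by
    rw [Algebra.smul_def]
    exact J.mul_mem_left _ _ hx

/-- The maximal two-sided ideal of the stalk of `ℂ^{n|m}` at the origin: the two-sided
ideal generated by the `r ⊗ 1` with `r` an analytic germ vanishing at `0`, together with
the `1 ⊗ ι v` for `v ∈ ℂᵐ`. -/
noncomputable def superVanishingIdeal (n m : ℕ) : TwoSidedIdeal (SuperStalk n m) :=
  TwoSidedIdeal.span
    ({x | ∃ r ∈ vanishingIdeal n, x = r ⊗ₜ[ℂ] (1 : ExteriorAlgebra ℂ (Fin m → ℂ))} ∪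
     {x | ∃ v : Fin m → ℂ, x = (1 : analyticGerms n) ⊗ₜ[ℂ] ExteriorAlgebra.ι ℂ v})


/-- **Hadamard's lemma** for analytic functions: a function analytic at the origin of `ℂⁿ` and
vanishing there is a combination of the coordinates with analytic coefficients. -/
theorem AnalyticAt.exists_eventuallyEq_sum_coord_mul {n : ℕ} {f : (Fin n → ℂ) → ℂ}
    (hf : AnalyticAt ℂ f 0) (h0 : f 0 = 0) :
    ∃ g : Fin n → (Fin n → ℂ) → ℂ, (∀ i, AnalyticAt ℂ (g i) 0) ∧
      f =ᶠ[𝓝 0] fun z => ∑ i, z i * g i z := by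
  obtain ⟨p, r, hp⟩ := hf
  have hpos : 0 < p.shift.radius := by
    rw [FormalMultilinearSeries.radius_shift]
    exact hp.r_pos.trans_le hp.r_le
  have hs := p.shift.hasFPowerSeriesOnBall hpos
  refine ⟨fun i z => p.shift.sum z (Pi.single i 1), fun i => ?_, ?_⟩
  · exact ((ContinuousLinearMap.apply ℂ ℂ (Pi.single i (1 : ℂ) : Fin n → ℂ)).analyticAt _).comp
      hs.analyticAt
  · have hu := hs.unshift (z := (0 : ℂ))
    filter_upwards [hp.eventually_hasSum, hu.eventually_hasSum] with z h1 h2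
    have h3 : ∀ k, (p.shift.unshift (0 : ℂ)) k (fun _ => z) = p k (fun _ => z) := by
      rintro (_ | k)
      · rw [hp.coeff_zero, hu.coeff_zero, h0]
        simp
      · simp [FormalMultilinearSeries.unshift, FormalMultilinearSeries.shift,
          continuousMultilinearCurryRightEquiv_symm_apply', ContinuousMultilinearMap.curryRight_apply]
    simp only [h3, zero_add, sub_zero] at h1 h2
    rw [h1.unique h2]
    conv_lhs => rw [pi_eq_sum_univ' z]
    simp only [map_sum, map_smul, smul_eq_mul]
    refine Finset.sum_congr rfl fun i _ => ?_
    congr 3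
    ext j
    simp [Pi.single_apply]

/-- The coordinate germs on `ℂⁿ`. -/
noncomputable def coordGerm (n : ℕ) (i : Fin n) : analyticGerms n :=
  ⟨((fun z => z i : (Fin n → ℂ) → ℂ) : Filter.Germ (𝓝 (0 : Fin n → ℂ)) ℂ), fun z => z i,
    (ContinuousLinearMap.proj (R := ℂ) (φ := fun _ : Fin n => ℂ) i).analyticAt 0, rfl⟩

theorem coordGerm_mem (n : ℕ) (i : Fin n) : coordGerm n i ∈ vanishingIdeal n := by
  rw [vanishingIdeal, RingHom.mem_ker]
  rfl

/-- Every germ vanishing at the origin lies in the ideal generated by the coordinates. -/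
theorem vanishingIdeal_le_span_coordGerm (n : ℕ) :
    (vanishingIdeal n).restrictScalars ℂ ≤
      Submodule.span ℂ (Set.range (coordGerm n)) * ⊤ := by
  rintro ⟨_, f, hf, rfl⟩ hr
  have h0 : f 0 = 0 := hr
  obtain ⟨g, hg, hfg⟩ := hf.exists_eventuallyEq_sum_coord_mul h0
  let G : Fin n → analyticGerms n := fun i => ⟨(g i : Filter.Germ _ ℂ), g i, hg i, rfl⟩
  have : (⟨(f : Filter.Germ (𝓝 (0 : Fin n → ℂ)) ℂ), f, hf, rfl⟩ : analyticGerms n) =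
      ∑ i, coordGerm n i * G i := by
    apply Subtype.ext
    rw [AddSubmonoidClass.coe_finsetSum]
    refine (Filter.Germ.coe_eq.2 hfg).trans ?_
    have := map_sum (Filter.Germ.coeRingHom (R := ℂ) (𝓝 (0 : Fin n → ℂ)))
      (fun i z => z i * g i z) Finset.univ
    refine Eq.trans ?_ this
    congr 1
    ext z
    simp
  rw [this]
  exact Submodule.sum_mem _ fun i _ => Submodule.mul_mem_mul
    (Submodule.subset_span ⟨i, rfl⟩) trivial

theorem isUnit_of_evalAtZero_ne_zero {n : ℕ} {r : analyticGerms n} (h : evalAtZero n r ≠ 0) :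
    IsUnit r := by
  obtain ⟨_, f, hf, rfl⟩ := r
  have h0 : f 0 ≠ 0 := h
  refine IsUnit.of_mul_eq_one ⟨((fun z => (f z)⁻¹ : (Fin n → ℂ) → ℂ) : Filter.Germ _ ℂ), _,
    hf.inv h0, rfl⟩ (Subtype.ext ?_)
  refine Filter.Germ.coe_eq.2 (?_ : (fun z => f z * (f z)⁻¹) =ᶠ[𝓝 0] fun _ => 1)
  filter_upwards [hf.continuousAt.eventually_ne h0] with z hz
  exact mul_inv_cancel₀ hz

theorem top_le_one_sup_vanishingIdeal (n : ℕ) :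
    (⊤ : Submodule ℂ (analyticGerms n)) ≤ 1 ⊔ (vanishingIdeal n).restrictScalars ℂ := by
  intro r _
  refine Submodule.mem_sup.2 ⟨algebraMap ℂ _ (evalAtZero n r),
    Submodule.algebraMap_mem _, r - algebraMap ℂ _ (evalAtZero n r), ?_, by simp⟩
  rw [Submodule.restrictScalars_mem, vanishingIdeal, RingHom.mem_ker, map_sub, sub_eq_zero]
  rfl

/-- If `R = ℂ + P` and `P = Z R` with `Z` finite-dimensional, then every power of `P` has finite
codimension. -/
theorem exists_fg_top_le_sup_pow {R : Type*} [CommRing R] [Algebra ℂ R] {P Z : Submodule ℂ R}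
    (h1 : ⊤ ≤ 1 ⊔ P) (hZ : Z.FG) (hZP : Z ≤ P) (hP : P ≤ Z * ⊤) (k : ℕ) :
    ∃ F : Submodule ℂ R, F.FG ∧ ⊤ ≤ F ⊔ P ^ (k + 1) := by
  have hone : (1 : Submodule ℂ R).FG := by
    rw [Submodule.one_eq_span]
    exact Submodule.fg_span_singleton 1
  induction k with
  | zero => exact ⟨1, hone, by simpa using h1⟩
  | succ k ih =>
    obtain ⟨F, hF, hk⟩ := ih
    refine ⟨1 ⊔ Z * F, hone.sup (hZ.mul hF), h1.trans ?_⟩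
    rw [sup_assoc]
    refine sup_le_sup_left (hP.trans ?_) _
    calc Z * ⊤ ≤ Z * (F ⊔ P ^ (k + 1)) := by gcongr
      _ = Z * F ⊔ Z * P ^ (k + 1) := Submodule.mul_sup _ _ _
      _ ≤ Z * F ⊔ P ^ (k + 1 + 1) := by
        rw [pow_succ' P (k + 1)]
        exact sup_le_sup_left (mul_le_mul_left hZP _) _

/-- An ideal of finite codimension in the ring of analytic germs contains a power of the maximal
ideal. -/
theorem exists_vanishingIdeal_pow_le {n : ℕ} (K : Ideal (analyticGerms n))
    [FiniteDimensional ℂ (analyticGerms n ⧸ K)] : ∃ k, vanishingIdeal n ^ k ≤ K := by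
  have : IsArtinianRing (analyticGerms n ⧸ K) :=
    isArtinian_of_tower ℂ (inferInstance : IsArtinian ℂ (analyticGerms n ⧸ K))
  obtain ⟨k, hk⟩ := IsArtinianRing.isNilpotent_jacobson_bot (R := analyticGerms n ⧸ K)
  refine ⟨k, ?_⟩
  have hle : (vanishingIdeal n).map (Ideal.Quotient.mk K) ≤ Ideal.jacobson ⊥ := by
    rw [Ideal.map_le_iff_le_comap]
    intro r hr
    rw [Ideal.mem_comap, Ideal.mem_jacobson_bot]
    intro y
    obtain ⟨y, rfl⟩ := Ideal.Quotient.mk_surjective y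
    rw [← map_mul, ← map_one (Ideal.Quotient.mk K), ← map_add]
    refine IsUnit.map _ (isUnit_of_evalAtZero_ne_zero ?_)
    rw [vanishingIdeal, RingHom.mem_ker] at hr
    simp [hr]
  have := Ideal.pow_right_mono hle k
  rw [hk, ← Ideal.map_pow, Ideal.zero_eq_bot, le_bot_iff, Ideal.map_eq_bot_iff_le_ker,
    Ideal.mk_ker] at this
  exact this

theorem exteriorPower_eq_bot_of_lt (m : ℕ) :
    (LinearMap.range (ExteriorAlgebra.ι ℂ (M := Fin m → ℂ))) ^ (m + 1) = ⊥ := by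
  have := ExteriorAlgebra.ιMulti_span_fixedDegree (M := Fin m → ℂ) ℂ (m + 1)
  refine this.symm.trans ?_
  rw [Submodule.span_eq_bot]
  rintro _ ⟨v, rfl⟩
  refine AlternatingMap.map_linearDependent _ _ fun h => ?_
  have := h.fintype_card_le_finrank
  simp at this

/-- Left multiplication preserves the right ideal of the exterior algebra generated by vectors. -/
theorem ExteriorAlgebra.top_mul_range_ι_le (V : Type*) [AddCommGroup V] [Module ℂ V] :
    ⊤ * LinearMap.range (ExteriorAlgebra.ι ℂ (M := V)) ≤
      LinearMap.range (ExteriorAlgebra.ι ℂ (M := V)) * ⊤ := by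
  rw [Submodule.mul_le]
  intro x _
  induction x using ExteriorAlgebra.induction with
  | algebraMap c =>
    intro v hv
    rw [Algebra.commutes]
    exact Submodule.mul_mem_mul hv trivial
  | ι w => exact fun v _ => Submodule.mul_mem_mul ⟨w, rfl⟩ trivial
  | mul x y hx hy =>
    intro v hv
    rw [mul_assoc]
    refine Submodule.mul_induction_on (hy trivial v hv) (fun u hu t _ => ?_) fun a b ha hb => ?_
    · rw [← mul_assoc]
      have := Submodule.mul_mem_mul (hx trivial u hu) (Submodule.mem_top (x := t) (R := ℂ))
      rw [mul_assoc] at this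
      exact (mul_le_mul_right le_top _ : _ ≤ LinearMap.range (ExteriorAlgebra.ι ℂ (M := V)) * ⊤) this
    · rw [mul_add]
      exact add_mem ha hb
  | add x y hx hy =>
    intro v hv
    rw [add_mul]
    exact add_mem (hx trivial v hv) (hy trivial v hv)

instance (m : ℕ) : FiniteDimensional ℂ (ExteriorAlgebra ℂ (Fin m → ℂ)) :=
  (Pi.basisFun ℂ (Fin m)).ExteriorAlgebra.finiteDimensional_of_finite

/-- A power of a sum of commuting subspaces lies in a two-sided ideal if a power of each does. -/
theorem Submodule.add_pow_le_of_commute {A : Type*} [Ring A] [Algebra ℂ A]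
    {S T : Submodule ℂ A} (h : Commute S T) (J : TwoSidedIdeal A) {k l : ℕ}
    (hS : S ^ k ≤ tsiToSubmodule J) (hT : T ^ l ≤ tsiToSubmodule J) :
    (S + T) ^ (k + l) ≤ tsiToSubmodule J := by
  rw [h.add_pow']
  refine Finset.sum_induction _ (· ≤ tsiToSubmodule J) (fun _ _ ha hb => sup_le ha hb) bot_le ?_
  rintro ⟨i, j⟩ hij
  rw [Finset.HasAntidiagonal.mem_antidiagonal] at hij
  have key : S ^ i * T ^ j ≤ tsiToSubmodule J := by
    rcases le_or_gt k i with hi | hi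
    · obtain ⟨i, rfl⟩ := Nat.exists_eq_add_of_le' hi
      rw [pow_add, mul_assoc, Submodule.mul_le]
      have h' : S ^ k * T ^ j ≤ tsiToSubmodule J :=
        Submodule.mul_le.2 fun x hx y _ => J.mul_mem_right _ _ (hS hx)
      exact fun x _ y hy => J.mul_mem_left _ _ (h' hy)
    · obtain ⟨j, rfl⟩ := Nat.exists_eq_add_of_le' (show l ≤ j by simp at hij; omega)
      have h' : T ^ j * T ^ l ≤ tsiToSubmodule J :=
        Submodule.mul_le.2 fun x _ y hy => J.mul_mem_left _ _ (hT hy)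
      rw [pow_add, Submodule.mul_le]
      exact fun x _ y hy => J.mul_mem_left _ _ (h' hy)
  generalize Nat.choose _ _ = c
  induction c with
  | zero => simp
  | succ c ih => rw [succ_nsmul]; exact sup_le ih key

/-- The two-sided ideal with a given underlying subspace. -/
def TwoSidedIdeal.ofSubmodule {A : Type*} [Ring A] [Algebra ℂ A] (S : Submodule ℂ A)
    (hl : ⊤ * S ≤ S) (hr : S * ⊤ ≤ S) : TwoSidedIdeal A :=
  .mk' S S.zero_mem S.add_mem S.neg_mem (fun h => hl (Submodule.mul_mem_mul trivial h))
    (fun h => hr (Submodule.mul_mem_mul h trivial))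

theorem tsiToSubmodule_span_le {A : Type*} [Ring A] [Algebra ℂ A] {s : Set A} {S : Submodule ℂ A}
    (hl : ⊤ * S ≤ S) (hr : S * ⊤ ≤ S) (hs : s ⊆ S) :
    tsiToSubmodule (TwoSidedIdeal.span s) ≤ S := by
  have : TwoSidedIdeal.span s ≤ TwoSidedIdeal.ofSubmodule S hl hr :=
    TwoSidedIdeal.span_le.2 fun x hx => by simpa [TwoSidedIdeal.ofSubmodule] using hs hx
  intro x hx
  simpa [TwoSidedIdeal.ofSubmodule] using this hx

theorem tsiToSubmodule_tsiPow_le {A : Type*} [Ring A] [Algebra ℂ A] {I : TwoSidedIdeal A}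
    {G : Submodule ℂ A} (hG : ⊤ * G ≤ G * ⊤) (hI : tsiToSubmodule I ≤ G * ⊤) (k : ℕ) :
    tsiToSubmodule (tsiPow I (k + 1)) ≤ G ^ (k + 1) * ⊤ := by
  have hpow : ∀ k, ⊤ * G ^ k ≤ G ^ k * ⊤ := by
    intro k
    induction k with
    | zero => simp
    | succ k ih =>
      calc ⊤ * G ^ (k + 1) = ⊤ * G ^ k * G := by rw [pow_succ, mul_assoc]
        _ ≤ G ^ k * ⊤ * G := mul_le_mul_left ih _
        _ = G ^ k * (⊤ * G) := mul_assoc _ _ _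
        _ ≤ G ^ k * (G * ⊤) := mul_le_mul_right hG _
        _ = G ^ (k + 1) * ⊤ := by rw [pow_succ, mul_assoc]
  induction k with
  | zero => simpa [tsiPow] using hI
  | succ k ih =>
    refine tsiToSubmodule_span_le ?_ ?_ ?_
    · rw [← mul_assoc]
      refine (mul_le_mul_left (hpow _) _).trans ?_
      rw [mul_assoc]
      exact mul_le_mul_right le_top _
    · rw [mul_assoc]
      exact mul_le_mul_right le_top _
    · rintro _ ⟨a, ha, b, hb, rfl⟩
      have := Submodule.mul_mem_mul (ih ha) (hI hb)
      refine (?_ : _ ≤ G ^ (k + 1 + 1) * (⊤ : Submodule ℂ A)) this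
      calc G ^ (k + 1) * ⊤ * (G * ⊤) = G ^ (k + 1) * (⊤ * G) * ⊤ := by simp only [mul_assoc]
        _ ≤ G ^ (k + 1) * (G * ⊤) * ⊤ :=
          mul_le_mul_left (mul_le_mul_right hG _) _
        _ = G ^ (k + 1 + 1) * (⊤ * ⊤) := by rw [pow_succ _ (k + 1)]; simp only [mul_assoc]
        _ ≤ _ := mul_le_mul_right le_top _

theorem pow_le_tsiToSubmodule_tsiPow {A : Type*} [Ring A] [Algebra ℂ A] {I : TwoSidedIdeal A}
    {S : Submodule ℂ A} (hS : S ≤ tsiToSubmodule I) (k : ℕ) :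
    S ^ (k + 1) ≤ tsiToSubmodule (tsiPow I (k + 1)) := by
  induction k with
  | zero => simpa [tsiPow] using hS
  | succ k ih =>
    rw [pow_succ, Submodule.mul_le]
    exact fun a ha b hb => TwoSidedIdeal.subset_span ⟨a, ih ha, b, hS hb, rfl⟩

namespace SuperStalk

variable (n m : ℕ)

/-- The inclusion of the analytic germs in the stalk. -/
noncomputable abbrev inl : analyticGerms n →ₐ[ℂ] SuperStalk n m :=
  Algebra.TensorProduct.includeLeft

/-- The inclusion of the exterior algebra in the stalk. -/
noncomputable abbrev inr : ExteriorAlgebra ℂ (Fin m → ℂ) →ₐ[ℂ] SuperStalk n m :=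
  Algebra.TensorProduct.includeRight

/-- The germs vanishing at the origin, as a subspace of the stalk. -/
noncomputable def evenPart : Submodule ℂ (SuperStalk n m) :=
  ((vanishingIdeal n).restrictScalars ℂ).map (inl n m).toLinearMap

/-- The odd coordinates, as a subspace of the stalk. -/
noncomputable def oddPart : Submodule ℂ (SuperStalk n m) :=
  (LinearMap.range (ExteriorAlgebra.ι ℂ (M := Fin m → ℂ))).map (inr n m).toLinearMap

theorem commute_map (S : Submodule ℂ (analyticGerms n))
    (T : Submodule ℂ (ExteriorAlgebra ℂ (Fin m → ℂ))) :
    Commute (S.map (inl n m).toLinearMap) (T.map (inr n m).toLinearMap) := by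
  refine Submodule.mul_comm_of_commute ?_
  rintro _ ⟨r, _, rfl⟩ _ ⟨t, _, rfl⟩
  simp [commute_iff_eq]

theorem top_eq : (⊤ : Submodule ℂ (SuperStalk n m)) =
    (⊤ : Submodule ℂ (analyticGerms n)).map (inl n m).toLinearMap *
      (⊤ : Submodule ℂ (ExteriorAlgebra ℂ (Fin m → ℂ))).map (inr n m).toLinearMap := by
  refine (top_unique fun x _ => ?_).symm
  induction x using TensorProduct.induction_on with
  | zero => exact zero_mem _
  | tmul r t =>
    have : r ⊗ₜ[ℂ] t = inl n m r * inr n m t := by simp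
    rw [this]
    exact Submodule.mul_mem_mul ⟨r, trivial, rfl⟩ ⟨t, trivial, rfl⟩
  | add x y hx hy => exact add_mem (hx trivial) (hy trivial)

theorem top_mul_generators_le :
    ⊤ * (evenPart n m + oddPart n m) ≤ (evenPart n m + oddPart n m) * ⊤ := by
  rw [mul_add, add_mul]
  refine sup_le_sup ?_ ?_
  · refine le_of_eq ?_
    rw [top_eq, mul_assoc, evenPart, ← (commute_map n m _ _).eq, ← mul_assoc, ← mul_assoc,
      ← Submodule.map_mul, ← Submodule.map_mul, mul_comm]
  · rw [top_eq, mul_assoc, oddPart, ← Submodule.map_mul]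
    refine (mul_le_mul_right
      (Submodule.map_mono (ExteriorAlgebra.top_mul_range_ι_le _)) _).trans ?_
    rw [Submodule.map_mul, ← mul_assoc, (commute_map n m _ _).eq, mul_assoc]

theorem superVanishingIdeal_le :
    tsiToSubmodule (superVanishingIdeal n m) ≤ (evenPart n m + oddPart n m) * ⊤ := by
  refine tsiToSubmodule_span_le ?_ ?_ ?_
  · rw [← mul_assoc]
    refine (mul_le_mul_left (top_mul_generators_le n m) _).trans ?_
    rw [mul_assoc]
    exact mul_le_mul_right le_top _
  · rw [mul_assoc]
    exact mul_le_mul_right le_top _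
  · have h : ∀ x ∈ evenPart n m + oddPart n m,
        x ∈ (evenPart n m + oddPart n m) * (⊤ : Submodule ℂ (SuperStalk n m)) := fun x hx => by
      simpa using Submodule.mul_mem_mul hx (Submodule.mem_top (x := (1 : SuperStalk n m)) (R := ℂ))
    rintro x (⟨r, hr, rfl⟩ | ⟨v, rfl⟩)
    · exact h _ (Submodule.mem_sup_left ⟨r, hr, rfl⟩)
    · exact h _ (Submodule.mem_sup_right ⟨_, ⟨v, rfl⟩, rfl⟩)

theorem evenPart_le : evenPart n m ≤ tsiToSubmodule (superVanishingIdeal n m) := by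
  rintro _ ⟨r, hr, rfl⟩
  exact TwoSidedIdeal.subset_span (Or.inl ⟨r, hr, rfl⟩)

/-- Powers of the maximal ideal of the stalk have finite codimension. -/
theorem finiteDimensional_quotient_pow (k : ℕ) :
    FiniteDimensional ℂ
      (SuperStalk n m ⧸ tsiToSubmodule (tsiPow (superVanishingIdeal n m) (k + 1))) := by
  set J := tsiPow (superVanishingIdeal n m) (k + 1)
  obtain ⟨F, hF, htop⟩ := exists_fg_top_le_sup_pow (top_le_one_sup_vanishingIdeal n)
    (Submodule.fg_span (Set.finite_range (coordGerm n)))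
    (Submodule.span_le.2 (Set.range_subset_iff.2 (coordGerm_mem n)))
    (vanishingIdeal_le_span_coordGerm n) k
  set F' := F.map (inl n m).toLinearMap *
    (⊤ : Submodule ℂ (ExteriorAlgebra ℂ (Fin m → ℂ))).map (inr n m).toLinearMap with hF'
  have hfg : F'.FG := (hF.map _).mul (Module.Finite.fg_top.map _)
  have hsup : ⊤ ≤ F' ⊔ tsiToSubmodule J := by
    rw [top_eq]
    refine (mul_le_mul_left (Submodule.map_mono htop) _).trans ?_
    rw [Submodule.map_sup, Submodule.sup_mul]
    refine sup_le_sup_left ?_ _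
    rw [Submodule.map_pow, Submodule.mul_le]
    exact fun x hx y _ => J.mul_mem_right _ _ (pow_le_tsiToSubmodule_tsiPow (evenPart_le n m) k hx)
  refine ⟨?_⟩
  have : (⊤ : Submodule ℂ (SuperStalk n m ⧸ tsiToSubmodule J)) =
      F'.map (tsiToSubmodule J).mkQ := by
    have := congrArg (Submodule.map (tsiToSubmodule J).mkQ) (top_unique hsup)
    rw [Submodule.map_sup, Submodule.map_top, Submodule.range_mkQ, Submodule.mkQ_map_self,
      sup_bot_eq] at this
    exact this.symm
  rw [this]
  exact hfg.map _

/-- A two-sided ideal of finite codimension contains a power of the maximal ideal. -/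
theorem exists_tsiPow_le (J : TwoSidedIdeal (SuperStalk n m))
    [FiniteDimensional ℂ (SuperStalk n m ⧸ tsiToSubmodule J)] :
    ∃ k, tsiToSubmodule (tsiPow (superVanishingIdeal n m) (k + 1)) ≤ tsiToSubmodule J := by
  let K : Ideal (analyticGerms n) := (J.comap (inl n m)).asIdeal
  have hK : ∀ r, r ∈ K ↔ inl n m r ∈ tsiToSubmodule J := fun r => by
    rw [TwoSidedIdeal.mem_asIdeal, TwoSidedIdeal.mem_comap]; rfl
  have : FiniteDimensional ℂ (analyticGerms n ⧸ K) := by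
    have hle : K.restrictScalars ℂ ≤ (tsiToSubmodule J).comap (inl n m).toLinearMap :=
      fun r hr => (hK r).1 hr
    have hf : Function.Injective (Submodule.mapQ (K.restrictScalars ℂ) (tsiToSubmodule J)
        (inl n m).toLinearMap hle) := by
      rw [← LinearMap.ker_eq_bot, Submodule.ker_mapQ, ← le_bot_iff, Submodule.map_le_iff_le_comap]
      intro r hr
      have : r ∈ K.restrictScalars ℂ := (hK r).2 hr
      simpa using this
    exact FiniteDimensional.of_injective _ hf
  obtain ⟨k, hk⟩ := exists_vanishingIdeal_pow_le K
  have heven : evenPart n m ^ (k + 1) ≤ tsiToSubmodule J := by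
    rw [evenPart, ← Submodule.map_pow, ← Submodule.restrictScalars_pow k.succ_ne_zero,
      Submodule.map_le_iff_le_comap]
    exact fun r hr => (hK r).1 (hk (Ideal.pow_le_pow_right k.le_succ hr))
  have hodd : oddPart n m ^ (m + 1) ≤ tsiToSubmodule J := by
    rw [oddPart, ← Submodule.map_pow, exteriorPower_eq_bot_of_lt, Submodule.map_bot]
    exact bot_le
  refine ⟨k + 1 + m, (tsiToSubmodule_tsiPow_le (top_mul_generators_le n m)
    (superVanishingIdeal_le n m) _).trans ?_⟩
  have := Submodule.add_pow_le_of_commute (commute_map n m _ _) J heven hodd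
  exact Submodule.mul_le.2 fun x hx y _ => J.mul_mem_right _ _ (this hx)

end SuperStalk

/-- A linear functional on the stalk at the origin of `ℂ^{n|m}` is a distribution
supported at the origin (i.e. vanishes on some power `J₀^{n+1}` of the maximal two-sided
ideal) if and only if its kernel contains a two-sided ideal of finite codimension. -/
theorem superStalk_distribution_iff_kernel_contains_finite_codimension_ideal
    (n m : ℕ) (φ : SuperStalk n m →ₗ[ℂ] ℂ) :
    (∃ N : ℕ, ∀ x ∈ tsiPow (superVanishingIdeal n m) (N + 1), φ x = 0) ↔
      (∃ J : TwoSidedIdeal (SuperStalk n m), (∀ x ∈ J, φ x = 0) ∧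
        FiniteDimensional ℂ (SuperStalk n m ⧸ tsiToSubmodule J)) := by
  constructor
  · rintro ⟨N, hN⟩
    exact ⟨_, hN, SuperStalk.finiteDimensional_quotient_pow n m N⟩
  · rintro ⟨J, hJ, hfin⟩
    obtain ⟨k, hk⟩ := SuperStalk.exists_tsiPow_le n m J
    exact ⟨k, fun x hx => hJ x (hk hx)⟩
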